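/- Let b̃ be an attractive hyperbolic solution of x' = −x² + q(t)x + p(t) with dichotomy constant pair (k_b, β_b). Then: (1) for every s ∈ ℝ and every x₀ ≥ b̃(s), the solution x(t,s,x₀) is defined for all t ≥ s and satisfies |b̃(t) − x(t,s,x₀)| ≤ k_b e^{−β_b(t−s)} |b̃(s) − x₀| for all t ≥ s; (2) for every β̄ ∈ (0, β_b) there exists ρ > 0 such that, for every s ∈ ℝ and every x₀ ∈ [b̃(s) − ρ, b̃(s)], the solution x(t,s,x₀) is defined for all t ≥ s and satisfies |b̃(t) − x(t,s,x₀)| ≤ k_b e^{−β̄(t−s)} |b̃(s) − x₀| for all t ≥ s. -/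

import Mathlib

open Set Filter

/-- The right-hand side of the quadratic equation `x' = -x² + Q(t)x + P(t)`. -/
def quadF (Q P : ℝ → ℝ) : ℝ → ℝ → ℝ := fun t x => -x ^ 2 + Q t * x + P t

/-- `b` is a globally defined bounded solution of `x' = -x² + Q(t)x + P(t)`. -/
def IsBddSol (Q P b : ℝ → ℝ) : Prop :=
  (∀ t, HasDerivAt b (quadF Q P t (b t)) t) ∧ ∃ C, ∀ t, |b t| ≤ C

/-- `(k, β)` is a dichotomy constant pair witnessing that the variational equation
`z' = (-2 b(t) + Q(t)) z` is Hurwitz at `+∞` (attractive case). -/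
def AttrDich (Q b : ℝ → ℝ) (k β : ℝ) : Prop :=
  1 ≤ k ∧ 0 < β ∧ ∀ s t : ℝ, s ≤ t →
    Real.exp (∫ l in s..t, (-2 * b l + Q l)) ≤ k * Real.exp (-β * (t - s))

/-- `(k, β)` is a dichotomy constant pair witnessing that the variational equation
`z' = (-2 b(t) + Q(t)) z` is Hurwitz at `−∞` (repulsive case). -/
def RepDich (Q b : ℝ → ℝ) (k β : ℝ) : Prop :=
  1 ≤ k ∧ 0 < β ∧ ∀ s t : ℝ, t ≤ s →
    Real.exp (∫ l in s..t, (-2 * b l + Q l)) ≤ k * Real.exp (β * (t - s))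

/-- `b` is an attractive hyperbolic solution of `x' = -x² + Q(t)x + P(t)`. -/
def IsAttrHyp (Q P b : ℝ → ℝ) : Prop := IsBddSol Q P b ∧ ∃ k β : ℝ, AttrDich Q b k β

/-- `b` is a repulsive hyperbolic solution of `x' = -x² + Q(t)x + P(t)`. -/
def IsRepHyp (Q P b : ℝ → ℝ) : Prop := IsBddSol Q P b ∧ ∃ k β : ℝ, RepDich Q b k β

/-- `b` is a hyperbolic solution of `x' = -x² + Q(t)x + P(t)`. -/
def IsHyp (Q P b : ℝ → ℝ) : Prop := IsAttrHyp Q P b ∨ IsRepHyp Q P b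

/-- The supremum norm distance between `f` and `g` is `< δ`. -/
def SupLt (f g : ℝ → ℝ) (δ : ℝ) : Prop := ∃ d : ℝ, d < δ ∧ ∀ t, |f t - g t| ≤ d

/-- The family of maximal solutions `t ↦ X t s x₀` of the scalar ODE `x' = h (t, x)`. -/
structure MaxSolFamily (h : ℝ → ℝ → ℝ) where
  X : ℝ → ℝ → ℝ → ℝ
  dom : ℝ → ℝ → Set ℝ
  dom_open : ∀ s x₀, IsOpen (dom s x₀)
  dom_ordConn : ∀ s x₀, (dom s x₀).OrdConnected
  mem_dom : ∀ s x₀, s ∈ dom s x₀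
  init : ∀ s x₀, X s s x₀ = x₀
  sol : ∀ s x₀, ∀ t ∈ dom s x₀, HasDerivAt (fun τ => X τ s x₀) (h t (X t s x₀)) t
  maximal : ∀ s x₀ (y : ℝ → ℝ) (I : Set ℝ), IsOpen I → I.OrdConnected → s ∈ I →
      y s = x₀ → (∀ t ∈ I, HasDerivAt y (h t (y t)) t) →
      I ⊆ dom s x₀ ∧ ∀ t ∈ I, y t = X t s x₀

/-- The solution `X · s x₀` is (defined and) bounded as `t → −∞`. -/
def BddAtBot {h : ℝ → ℝ → ℝ} (F : MaxSolFamily h) (s x₀ : ℝ) : Prop :=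
  ∃ C : ℝ, ∀ᶠ t in atBot, t ∈ F.dom s x₀ ∧ |F.X t s x₀| ≤ C

/-- The solution `X · s x₀` is (defined and) bounded as `t → ∞`. -/
def BddAtTop {h : ℝ → ℝ → ℝ} (F : MaxSolFamily h) (s x₀ : ℝ) : Prop :=
  ∃ C : ℝ, ∀ᶠ t in atTop, t ∈ F.dom s x₀ ∧ |F.X t s x₀| ≤ C

/-- `a` is the globally defined bounded solution characterized by:
`X · s x₀` is bounded as `t → −∞` iff `x₀ ≤ a s`. -/
def CharA {h : ℝ → ℝ → ℝ} (F : MaxSolFamily h) (a : ℝ → ℝ) : Prop :=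
  (∀ t, HasDerivAt a (h t (a t)) t) ∧ (∃ C, ∀ t, |a t| ≤ C) ∧
  ∀ s x₀ : ℝ, BddAtBot F s x₀ ↔ x₀ ≤ a s

/-- `r` is the globally defined bounded solution characterized by:
`X · s x₀` is bounded as `t → ∞` iff `x₀ ≥ r s`. -/
def CharR {h : ℝ → ℝ → ℝ} (F : MaxSolFamily h) (r : ℝ → ℝ) : Prop :=
  (∀ t, HasDerivAt r (h t (r t)) t) ∧ (∃ C, ∀ t, |r t| ≤ C) ∧
  ∀ s x₀ : ℝ, BddAtTop F s x₀ ↔ r s ≤ x₀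

/-- The solution at time `t` of the variational equation `z' = (-2 b(t) + Q(t)) z` along `b` with
value `1` at time `s`. -/
noncomputable def variationalSol (Q b : ℝ → ℝ) (s t : ℝ) : ℝ :=
  Real.exp (∫ l in s..t, (-2 * b l + Q l))

lemma variationalSol_pos (Q b : ℝ → ℝ) (s t : ℝ) : 0 < variationalSol Q b s t := Real.exp_pos _

lemma variationalSol_self (Q b : ℝ → ℝ) (s : ℝ) : variationalSol Q b s s = 1 := by
  simp [variationalSol]

lemma hasDerivAt_variationalSol {Q b : ℝ → ℝ} (hQ : Continuous Q) (hb : Continuous b) (s t : ℝ) :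
    HasDerivAt (variationalSol Q b s) (variationalSol Q b s t * (-2 * b t + Q t)) t := by
  have hc : Continuous fun l => -2 * b l + Q l := by fun_prop
  exact (hc.integral_hasStrictDerivAt s t).hasDerivAt.exp

lemma continuous_variationalSol {Q b : ℝ → ℝ} (hQ : Continuous Q) (hb : Continuous b) (s : ℝ) :
    Continuous (variationalSol Q b s) :=
  continuous_iff_continuousAt.2 fun t => (hasDerivAt_variationalSol hQ hb s t).continuousAt

/-- The difference of a solution of the quadratic equation from `b` solves a Bernoulli equation,
which gives an explicit formula for the solutions lasting as long as the denominator is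
positive. -/
lemma MaxSolFamily.eq_add_div {Q P : ℝ → ℝ} (F : MaxSolFamily (quadF Q P)) (hQ : Continuous Q)
    {b : ℝ → ℝ} (hb : ∀ t, HasDerivAt b (quadF Q P t (b t)) t) {s x₀ t : ℝ}
    (hD : 0 < 1 + (x₀ - b s) * ∫ l in s..t, variationalSol Q b s l) :
    t ∈ F.dom s x₀ ∧ F.X t s x₀ = b t + (x₀ - b s) * variationalSol Q b s t /
      (1 + (x₀ - b s) * ∫ l in s..t, variationalSol Q b s l) := by
  have hbc : Continuous b := continuous_iff_continuousAt.2 fun t => (hb t).continuousAt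
  set E := variationalSol Q b s with hE
  set y₀ := x₀ - b s with hy₀
  have hEc : Continuous E := continuous_variationalSol hQ hbc s
  have hEpos : ∀ t, 0 < E t := variationalSol_pos Q b s
  set D : ℝ → ℝ := fun t => 1 + y₀ * ∫ l in s..t, E l with hDdef
  have hDd : ∀ t, HasDerivAt D (y₀ * E t) t := fun t =>
    ((hEc.integral_hasStrictDerivAt s t).hasDerivAt.const_mul y₀).const_add 1
  have hDc : Continuous D := continuous_iff_continuousAt.2 fun t => (hDd t).continuousAt
  have hDs : D s = 1 := by simp [hDdef]
  have hord : {t | 0 < D t}.OrdConnected := by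
    rcases le_total 0 y₀ with h | h
    · have hmono : Monotone D := monotone_of_deriv_nonneg (fun t => (hDd t).differentiableAt)
        fun t => by rw [(hDd t).deriv]; exact mul_nonneg h (hEpos t).le
      exact ⟨fun u hu v _ w hw => lt_of_lt_of_le hu (hmono hw.1)⟩
    · have hanti : Antitone D := antitone_of_deriv_nonpos (fun t => (hDd t).differentiableAt)
        fun t => by rw [(hDd t).deriv]; exact mul_nonpos_of_nonpos_of_nonneg h (hEpos t).le
      exact ⟨fun u _ v hv w hw => lt_of_lt_of_le hv (hanti hw.2)⟩
  have hsol : ∀ t ∈ {t | 0 < D t},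
      HasDerivAt (fun t => b t + y₀ * E t / D t) (quadF Q P t (b t + y₀ * E t / D t)) t := by
    intro t ht
    have hne : D t ≠ 0 := ne_of_gt ht
    refine ((hb t).add (((hasDerivAt_variationalSol hQ hbc s t).const_mul y₀).div
      (hDd t) hne)).congr_deriv ?_
    simp only [quadF, ← hE]
    field_simp
    ring
  obtain ⟨hsub, hval⟩ := F.maximal s x₀ _ {t | 0 < D t} (isOpen_lt continuous_const hDc) hord
    (by simp [hDs]) (by simp [hDs, hE, variationalSol_self, hy₀]) hsol
  exact ⟨hsub hD, (hval t hD).symm⟩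

/-- An exponential bound on the solutions of the variational equation, integrated. -/
lemma AttrDich.integral_variationalSol_le {Q b : ℝ → ℝ} {k β : ℝ} (h : AttrDich Q b k β)
    (hQ : Continuous Q) (hb : Continuous b) {s t : ℝ} (hst : s ≤ t) :
    ∫ l in s..t, variationalSol Q b s l ≤ k / β * (1 - Real.exp (-β * (t - s))) := by
  obtain ⟨-, hβ, hexp⟩ := h
  have hd : ∀ l ∈ uIcc s t, HasDerivAt (fun l => -(k / β) * Real.exp (-β * (l - s)))
      (k * Real.exp (-β * (l - s))) l := fun l _ => by
    refine (((((hasDerivAt_id l).sub_const s).const_mul (-β)).exp).const_mul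
      (-(k / β))).congr_deriv ?_
    simp only [id]
    field_simp
  have hc : Continuous fun l => k * Real.exp (-β * (l - s)) := by fun_prop
  calc ∫ l in s..t, variationalSol Q b s l
      ≤ ∫ l in s..t, k * Real.exp (-β * (l - s)) :=
        intervalIntegral.integral_mono_on hst
          ((continuous_variationalSol hQ hb s).intervalIntegrable s t)
          (hc.intervalIntegrable s t) fun l hl => hexp s l hl.1
    _ = k / β * (1 - Real.exp (-β * (t - s))) := by
        rw [intervalIntegral.integral_eq_sub_of_hasDerivAt hd (hc.intervalIntegrable s t)]
        simp only [sub_self, mul_zero, Real.exp_zero]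
        ring

lemma Real.exp_mul_le_one_sub_mul {θ : ℝ} (h₀ : 0 ≤ θ) (h₁ : θ ≤ 1) (x : ℝ) :
    Real.exp (θ * x) ≤ 1 - θ * (1 - Real.exp x) := by
  have h := convexOn_exp.2 (mem_univ x) (mem_univ 0) h₀ (sub_nonneg.2 h₁) (by ring)
  simp only [smul_eq_mul, mul_zero, add_zero, Real.exp_zero, mul_one] at h
  linarith

theorem stmt6 (q p : ℝ → ℝ)
    (hqb : ∃ C, ∀ t, |q t| ≤ C) (hqu : UniformContinuous q)
    (hpb : ∃ C, ∀ t, |p t| ≤ C) (hpu : UniformContinuous p)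
    (F : MaxSolFamily (quadF q p))
    (b : ℝ → ℝ) (kb βb : ℝ)
    (hb : IsBddSol q p b) (hdich : AttrDich q b kb βb) :
    -- (1)
    (∀ s x₀ : ℝ, b s ≤ x₀ →
      (∀ t, s ≤ t → t ∈ F.dom s x₀) ∧
      (∀ t, s ≤ t → |b t - F.X t s x₀| ≤ kb * Real.exp (-βb * (t - s)) * |b s - x₀|)) ∧
    -- (2)
    (∀ β' : ℝ, 0 < β' → β' < βb → ∃ ρ > (0:ℝ), ∀ s x₀ : ℝ,
      b s - ρ ≤ x₀ → x₀ ≤ b s →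
      (∀ t, s ≤ t → t ∈ F.dom s x₀) ∧
      (∀ t, s ≤ t → |b t - F.X t s x₀| ≤ kb * Real.exp (-β' * (t - s)) * |b s - x₀|)) := by
  have hqc : Continuous q := hqu.continuous
  have hbc : Continuous b := continuous_iff_continuousAt.2 fun t => (hb.1 t).continuousAt
  obtain ⟨hk, hβ, hexp⟩ := id hdich
  have hk0 : 0 < kb := one_pos.trans_le hk
  have habs : ∀ s t x₀ : ℝ, 0 < 1 + (x₀ - b s) * ∫ l in s..t, variationalSol q b s l →
      |b t - F.X t s x₀| = variationalSol q b s t /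
        (1 + (x₀ - b s) * ∫ l in s..t, variationalSol q b s l) * |b s - x₀| := by
    intro s t x₀ hD
    rw [(F.eq_add_div hqc hb.1 hD).2, sub_add_cancel_left, abs_neg, abs_div, abs_mul,
      abs_of_pos hD, abs_of_pos (variationalSol_pos q b s t), abs_sub_comm x₀]
    ring
  refine ⟨fun s x₀ hx => ?_, fun β' hβ' hlt => ⟨(βb - β') / kb, div_pos (sub_pos.2 hlt) hk0,
    fun s x₀ hρ hx => ?_⟩⟩
  · have hD : ∀ t, s ≤ t → 1 ≤ 1 + (x₀ - b s) * ∫ l in s..t, variationalSol q b s l :=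
      fun t ht => le_add_of_nonneg_right <| mul_nonneg (sub_nonneg.2 hx) <|
        intervalIntegral.integral_nonneg ht fun l _ => (variationalSol_pos q b s l).le
    refine ⟨fun t ht => (F.eq_add_div hqc hb.1 (one_pos.trans_le (hD t ht))).1, fun t ht => ?_⟩
    rw [habs s t x₀ (one_pos.trans_le (hD t ht))]
    gcongr
    exact (div_le_self (variationalSol_pos q b s t).le (hD t ht)).trans (hexp s t ht)
  · have hD : ∀ t, s ≤ t → Real.exp (-(βb - β') * (t - s)) ≤
        1 + (x₀ - b s) * ∫ l in s..t, variationalSol q b s l := by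
      intro t ht
      have hJ := hdich.integral_variationalSol_le hqc hbc ht
      have hJ0 : 0 ≤ ∫ l in s..t, variationalSol q b s l :=
        intervalIntegral.integral_nonneg ht fun l _ => (variationalSol_pos q b s l).le
      have hconv := Real.exp_mul_le_one_sub_mul (θ := (βb - β') / βb)
        (div_nonneg (sub_pos.2 hlt).le hβ.le) ((div_le_one hβ).2 (by linarith)) (-βb * (t - s))
      have hmul : (b s - x₀) * ∫ l in s..t, variationalSol q b s l ≤
          (βb - β') / kb * (kb / βb * (1 - Real.exp (-βb * (t - s)))) :=
        mul_le_mul (by linarith) hJ hJ0 (div_pos (sub_pos.2 hlt) hk0).le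
      have hcancel : (βb - β') / kb * (kb / βb * (1 - Real.exp (-βb * (t - s)))) =
          (βb - β') / βb * (1 - Real.exp (-βb * (t - s))) := by
        field_simp
      have harg : (βb - β') / βb * (-βb * (t - s)) = -(βb - β') * (t - s) := by
        field_simp
      rw [harg] at hconv
      linarith
    have hD0 := fun t ht => (Real.exp_pos _).trans_le (hD t ht)
    refine ⟨fun t ht => (F.eq_add_div hqc hb.1 (hD0 t ht)).1, fun t ht => ?_⟩
    rw [habs s t x₀ (hD0 t ht)]
    gcongr
    rw [div_le_iff₀ (hD0 t ht)]
    calc variationalSol q b s t ≤ kb * Real.exp (-βb * (t - s)) := hexp s t ht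
      _ = kb * Real.exp (-β' * (t - s)) * Real.exp (-(βb - β') * (t - s)) := by
        rw [mul_assoc, ← Real.exp_add]
        ring_nf
      _ ≤ _ := by
        gcongr
        exact hD t ht
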